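/- (Identity Principle) Let Ω be a slice-domain in W and let f, g : Ω → ℝ^{2n} be weak slice regular. (i) If f = g on a nonempty subset of Ω ∩ ℝ^d that is open in ℝ^d, then f = g on Ω. (ii) If f = g on a nonempty subset of Ω ∩ ℂ_I^d that is open in ℂ_I^d, for some I ∈ 𝒞, then f = g on Ω. -/

import Mathlib

noncomputable section

/-- `ℝ^{2n}` as a Euclidean space. -/
abbrev V (n : ℕ) : Type := EuclideanSpace ℝ (Fin (2 * n))

/-- `End(ℝ^{2n})`: the (continuous, hence in finite dimension all) real-linear
endomorphisms of `ℝ^{2n}`; multiplication is composition. -/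
abbrev EndE (n : ℕ) : Type := V n →L[ℝ] V n

/-- The set `𝔠_n` of complex structures on `ℝ^{2n}`. -/
def CS (n : ℕ) : Set (EndE n) := {I | I * I = -1}

/-- The slice `ℂ_I = {x·id + y·I : x, y ∈ ℝ}`. -/
def CI {n : ℕ} (I : EndE n) : Set (EndE n) := {A | ∃ x y : ℝ, A = x • (1 : EndE n) + y • I}

/-- The slice `ℂ_I^d ⊆ [End(ℝ^{2n})]^d`. -/
def CId (n d : ℕ) (I : EndE n) : Set (Fin d → EndE n) := {q | ∀ ℓ, q ℓ ∈ CI I}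

/-- `ℝ^d` identified with the tuples `(x₁·id, …, x_d·id)`. -/
def RealSet (n d : ℕ) : Set (Fin d → EndE n) := {q | ∀ ℓ, ∃ x : ℝ, q ℓ = x • (1 : EndE n)}

/-- The weak slice-cone `W = ⋃_{I ∈ 𝒞} ℂ_I^d`. -/
def Wcone (n d : ℕ) (𝒞 : Set (EndE n)) : Set (Fin d → EndE n) := ⋃ I ∈ 𝒞, CId n d I

/-- `Ω` is slice-open: `Ω ⊆ W` and for every `I ∈ 𝒞`, `Ω ∩ ℂ_I^d` is open in the
Euclidean (subspace) topology of `ℂ_I^d`. -/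
def SliceOpen (n d : ℕ) (𝒞 : Set (EndE n)) (Ω : Set (Fin d → EndE n)) : Prop :=
  Ω ⊆ Wcone n d 𝒞 ∧ ∀ I ∈ 𝒞, ∃ U : Set (Fin d → EndE n), IsOpen U ∧ Ω ∩ CId n d I = U ∩ CId n d I

/-- The slice topology `τ_s`: a set is open iff its intersection with each slice `ℂ_I^d`
(`I ∈ 𝒞`) is open in the Euclidean topology of the slice. -/
def sliceTop (n d : ℕ) (𝒞 : Set (EndE n)) : TopologicalSpace (Fin d → EndE n) :=
  ⨆ I ∈ 𝒞, TopologicalSpace.coinduced (Subtype.val : CId n d I → Fin d → EndE n) inferInstance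

/-- A slice-domain: a nonempty slice-open set, connected in the slice topology. -/
def SliceDomain (n d : ℕ) (𝒞 : Set (EndE n)) (Ω : Set (Fin d → EndE n)) : Prop :=
  SliceOpen n d 𝒞 Ω ∧ @IsConnected _ (sliceTop n d 𝒞) Ω

/-- `Ω` is real-connected: `Ω ∩ ℝ^d` is connected (empty counts as connected). -/
def RealConnected (n d : ℕ) (Ω : Set (Fin d → EndE n)) : Prop :=
  IsPreconnected (Ω ∩ RealSet n d)

/-- Φ_I : ℝ^d × ℝ^d → [End(ℝ^{2n})]^d, (x, y) ↦ (x₁·id + y₁·I, …, x_d·id + y_d·I). -/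
def Phi (n d : ℕ) (I : EndE n) : (Fin d → ℝ) × (Fin d → ℝ) → Fin d → EndE n :=
  fun p ℓ => p.1 ℓ • (1 : EndE n) + p.2 ℓ • I

/-- The standard basis direction in the x-coordinates. -/
def ex (d : ℕ) (ℓ : Fin d) : (Fin d → ℝ) × (Fin d → ℝ) := (Pi.single ℓ 1, 0)

/-- The standard basis direction in the y-coordinates. -/
def ey (d : ℕ) (ℓ : Fin d) : (Fin d → ℝ) × (Fin d → ℝ) := (0, Pi.single ℓ 1)

/-- f is weak slice regular on Ω: for every I ∈ 𝒞, f ∘ Φ_I is (Fréchet, real)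
differentiable on Φ_I⁻¹(Ω) and satisfies the Cauchy–Riemann equations
∂(f∘Φ_I)/∂x_ℓ + I(∂(f∘Φ_I)/∂y_ℓ) = 0 there, for ℓ = 1, …, d. -/
def WSRegular (n d : ℕ) (𝒞 : Set (EndE n)) (Ω : Set (Fin d → EndE n))
    (f : (Fin d → EndE n) → V n) : Prop :=
  ∀ I ∈ 𝒞, DifferentiableOn ℝ (f ∘ Phi n d I) (Phi n d I ⁻¹' Ω) ∧
    ∀ p ∈ Phi n d I ⁻¹' Ω, ∀ ℓ : Fin d,
      fderiv ℝ (f ∘ Phi n d I) p (ex d ℓ) + I (fderiv ℝ (f ∘ Phi n d I) p (ey d ℓ)) = 0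

section helpers

open Topology

variable {n d : ℕ}

lemma scal_zero_alg {R : Type*} [Ring R] [Algebra ℝ R] [Nontrivial R] {J : R} (hJ : J * J = -1) {a b : ℝ}
    (h : a • (1 : R) + b • J = 0) : a = 0 ∧ b = 0 := by
  have h1 : (a • (1 : R) + b • J) * (a • (1 : R) - b • J) = (a ^ 2 + b ^ 2) • (1 : R) := by
    simp only [mul_sub, add_mul, smul_mul_assoc, mul_smul_comm, one_mul, mul_one, hJ]
    module
  rw [h, zero_mul] at h1
  have h2 : a ^ 2 + b ^ 2 = 0 := by
    by_contra hne
    have h3 := congrArg (fun w => (a ^ 2 + b ^ 2)⁻¹ • w) h1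
    simp only [smul_zero, smul_smul, inv_mul_cancel₀ hne, one_smul] at h3
    exact zero_ne_one h3
  constructor <;> nlinarith [sq_nonneg a, sq_nonneg b]

lemma slice_eq_alg {R : Type*} [Ring R] [Algebra ℝ R] [Nontrivial R] {I J : R} (hI : I * I = -1) (hJ : J * J = -1) {x y x' y' : ℝ}
    (h : x • (1 : R) + y • I = x' • (1 : R) + y' • J) :
    x = x' ∧ y • I = y' • J ∧ y ^ 2 = y' ^ 2 := by
  have h1 : y • I = (x' - x) • (1 : R) + y' • J := by
    rw [sub_smul, sub_add_eq_add_sub, ← h, add_sub_cancel_left]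
  have h2 : (y • I) * (y • I) = (-y ^ 2) • (1 : R) := by
    simp only [smul_mul_assoc, mul_smul_comm, hI]
    module
  have h3 : ((x' - x) • (1 : R) + y' • J) * ((x' - x) • (1 : R) + y' • J)
      = ((x' - x) ^ 2 - y' ^ 2) • (1 : R) + (2 * (x' - x) * y') • J := by
    simp only [mul_add, add_mul, smul_mul_assoc, mul_smul_comm, one_mul, mul_one, hJ]
    module
  rw [← h1, h2] at h3
  have h4 : ((x' - x) ^ 2 - y' ^ 2 + y ^ 2) • (1 : R) + (2 * (x' - x) * y') • J = 0 := by
    have : ((x' - x) ^ 2 - y' ^ 2 + y ^ 2) • (1 : R) + (2 * (x' - x) * y') • J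
      = (((x' - x) ^ 2 - y' ^ 2) • (1 : R) + (2 * (x' - x) * y') • J)
        - (-y ^ 2) • (1 : R) := by module
    rw [this, ← h3, sub_self]
  obtain ⟨h5, h6⟩ := scal_zero_alg hJ h4
  have hx : x' - x = 0 := by
    rcases mul_eq_zero.1 h6 with h | h
    · linarith
    · subst h; nlinarith [sq_nonneg (x' - x), sq_nonneg y]
  refine ⟨by linarith, by rw [h1, hx]; simp, ?_⟩
  rw [hx] at h5
  linarith

lemma nontriv_End (hn : 1 ≤ n) : Nontrivial (EndE n) := by
  have : Nonempty (Fin (2 * n)) := ⟨⟨0, by omega⟩⟩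
  have : Nontrivial (V n) := inferInstance
  infer_instance

lemma scal_zero (hn : 1 ≤ n) {J : EndE n} (hJ : J * J = -1) {a b : ℝ}
    (h : a • (1 : EndE n) + b • J = 0) : a = 0 ∧ b = 0 := by
  have := nontriv_End hn
  exact scal_zero_alg hJ h

lemma slice_eq (hn : 1 ≤ n) {I J : EndE n} (hI : I * I = -1) (hJ : J * J = -1) {x y x' y' : ℝ}
    (h : x • (1 : EndE n) + y • I = x' • (1 : EndE n) + y' • J) :
    x = x' ∧ y • I = y' • J ∧ y ^ 2 = y' ^ 2 := by
  have := nontriv_End hn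
  exact slice_eq_alg hI hJ h

lemma Phi_real (I : EndE n) (a : Fin d → ℝ) (ℓ : Fin d) :
    Phi n d I (a, 0) ℓ = a ℓ • (1 : EndE n) := by
  have h : (0 : ℝ) • I = 0 := zero_smul ℝ I
  simp only [Phi, Pi.zero_apply]
  rw [h, add_zero]

/-- The linear version of `Phi`. -/
def PhiL (n d : ℕ) (I : EndE n) : ((Fin d → ℝ) × (Fin d → ℝ)) →ₗ[ℝ] (Fin d → EndE n) where
  toFun := Phi n d I
  map_add' p q := by ext1 ℓ; simp only [Phi, Prod.fst_add, Prod.snd_add, Pi.add_apply]; module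
  map_smul' c p := by
    ext1 ℓ; simp only [Phi, Prod.smul_fst, Prod.smul_snd, Pi.smul_apply, smul_eq_mul, RingHom.id_apply]; module

lemma Phi_emb (hn : 1 ≤ n) {I : EndE n} (hI : I * I = -1) :
    Topology.IsClosedEmbedding (Phi n d I) := by
  apply (PhiL n d I).isClosedEmbedding_of_injective
  rw [LinearMap.ker_eq_bot']
  intro p hp
  have h (ℓ : Fin d) := scal_zero hn hI (congrFun hp ℓ : p.1 ℓ • (1 : EndE n) + p.2 ℓ • I = 0)
  ext ℓ
  · exact (h ℓ).1
  · exact (h ℓ).2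

lemma range_Phi (I : EndE n) : Set.range (Phi n d I) = CId n d I := by
  ext q
  constructor
  · rintro ⟨p, rfl⟩ ℓ
    exact ⟨p.1 ℓ, p.2 ℓ, rfl⟩
  · intro h
    choose x y h using h
    exact ⟨(x, y), funext fun ℓ => (h ℓ).symm⟩

lemma sliceTop_isOpen {𝒞 : Set (EndE n)} (hn : 1 ≤ n) (hcs : 𝒞 ⊆ CS n) {s : Set (Fin d → EndE n)}
    (h : ∀ I ∈ 𝒞, IsOpen (Phi n d I ⁻¹' s)) : IsOpen[sliceTop n d 𝒞] s := by
  unfold sliceTop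
  simp only [isOpen_iSup_iff, isOpen_coinduced]
  intro I hI
  obtain ⟨U, hU, hUs⟩ := (Phi_emb (d := d) hn (hcs hI)).isInducing.isOpen_iff.1 (h I hI)
  refine isOpen_induced_iff.2 ⟨U, hU, ?_⟩
  ext ⟨q, hq⟩
  rw [← range_Phi] at hq
  obtain ⟨p, rfl⟩ := hq
  exact Set.ext_iff.1 hUs p

lemma slice_open_pre {𝒞 : Set (EndE n)} (hn : 1 ≤ n) (hcs : 𝒞 ⊆ CS n) {Ω : Set (Fin d → EndE n)}
    (h : SliceOpen n d 𝒞 Ω) {I : EndE n} (hI : I ∈ 𝒞) : IsOpen (Phi n d I ⁻¹' Ω) := by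
  obtain ⟨U, hU, hUs⟩ := h.2 I hI
  convert hU.preimage (Phi_emb (d := d) hn (hcs hI)).continuous using 1
  ext p
  have := Set.ext_iff.1 hUs (Phi n d I p)
  simp only [Set.mem_inter_iff, ← range_Phi, Set.mem_range_self, and_true] at this
  exact this

/-- Multiplication by the imaginary unit on `ℝ^d × ℝ^d`. -/
def rot (v : (Fin d → ℝ) × (Fin d → ℝ)) : (Fin d → ℝ) × (Fin d → ℝ) := (-v.2, v.1)

lemma CR_all {I : EndE n} (hI : I * I = -1) (T : ((Fin d → ℝ) × (Fin d → ℝ)) →L[ℝ] V n)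
    (hT : ∀ ℓ, T (ex d ℓ) + I (T (ey d ℓ)) = 0) (v : (Fin d → ℝ) × (Fin d → ℝ)) :
    T (rot v) = I (T v) := by
  have hII : ∀ w, I (I w) = -w := fun w => by
    have := congrArg (fun A : EndE n => A w) hI
    simpa using this
  have h1 : ∀ ℓ, T (ex d ℓ) = - I (T (ey d ℓ)) := fun ℓ => eq_neg_of_add_eq_zero_left (hT ℓ)
  have h2 : ∀ ℓ, I (T (ex d ℓ)) = T (ey d ℓ) := fun ℓ => by rw [h1, map_neg, hII, neg_neg]
  have hdec : ∀ a b : Fin d → ℝ, ((a, b) : (Fin d → ℝ) × (Fin d → ℝ))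
      = ∑ ℓ, (a ℓ • ex d ℓ + b ℓ • ey d ℓ) := by
    intro a b
    ext k
    · simp [ex, ey, Prod.fst_sum, Finset.sum_apply, Pi.single_apply]
    · simp [ex, ey, Prod.snd_sum, Finset.sum_apply, Pi.single_apply]
  obtain ⟨a, b⟩ := v
  simp only [rot]
  rw [hdec (-b) a, hdec a b]
  simp only [map_sum, map_add, map_smul, Pi.neg_apply]
  refine Finset.sum_congr rfl fun ℓ _ => ?_
  rw [h2, h1]
  module

/-- Complex line. -/
def cline (p v : (Fin d → ℝ) × (Fin d → ℝ)) (t : ℂ) : (Fin d → ℝ) × (Fin d → ℝ) :=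
  p + (t.re • v + t.im • rot v)

/-- derivative of the complex line. -/
def clineL (v : (Fin d → ℝ) × (Fin d → ℝ)) : ℂ →L[ℝ] (Fin d → ℝ) × (Fin d → ℝ) :=
  Complex.reCLM.smulRight v + Complex.imCLM.smulRight (rot v)

lemma cline_eq (p v : (Fin d → ℝ) × (Fin d → ℝ)) (t : ℂ) : cline p v t = p + clineL v t := rfl

lemma cline_deriv (p v : (Fin d → ℝ) × (Fin d → ℝ)) (t : ℂ) :
    HasFDerivAt (cline p v) (clineL v) t :=
  ((clineL v).hasFDerivAt).const_add p

lemma line_id {I : EndE n} (hI : I * I = -1) {F : (Fin d → ℝ) × (Fin d → ℝ) → V n}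
    {U : Set ((Fin d → ℝ) × (Fin d → ℝ))} (hU : IsOpen U) (hUc : Convex ℝ U)
    (hF : ∀ p ∈ U, DifferentiableAt ℝ F p)
    (hCR : ∀ p ∈ U, ∀ ℓ, fderiv ℝ F p (ex d ℓ) + I (fderiv ℝ F p (ey d ℓ)) = 0)
    (p v : (Fin d → ℝ) × (Fin d → ℝ)) {t₀ t : ℂ} (h0 : cline p v t₀ ∈ U) (ht : cline p v t ∈ U)
    (hz : ∃ᶠ s in nhdsWithin t₀ {t₀}ᶜ, F (cline p v s) = 0) : F (cline p v t) = 0 := by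
  have hII : ∀ w, I (I w) = -w := fun w => by
    have := congrArg (fun A : EndE n => A w) hI
    simpa using this
  have hcont : Continuous (cline p v) :=
    continuous_iff_continuousAt.2 fun t => (cline_deriv p v t).continuousAt
  have hSo : IsOpen (cline p v ⁻¹' U) := hU.preimage hcont
  have hSc : Convex ℝ (cline p v ⁻¹' U) := by
    have h1 : Convex ℝ ((fun z => p + z) ⁻¹' U) := hUc.translate_preimage_right p
    exact h1.linear_preimage (clineL v).toLinearMap
  ext k
  let lam : V n →L[ℝ] ℝ := EuclideanSpace.proj k
  let M : V n →L[ℝ] ℂ := Complex.ofRealCLM.comp lam -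
    Complex.I • (Complex.ofRealCLM.comp (lam.comp I))
  have hM : ∀ w, M w = (lam w : ℂ) - Complex.I * (lam (I w) : ℂ) := fun w => rfl
  have hMI : ∀ w, M (I w) = Complex.I * M w := by
    intro w
    rw [hM, hM, hII, map_neg]
    push_cast
    linear_combination (lam (I w) : ℂ) * Complex.I_mul_I
  have hd : DifferentiableOn ℂ (fun s => M (F (cline p v s))) (cline p v ⁻¹' U) := by
    intro s hs
    apply DifferentiableAt.differentiableWithinAt
    have hD : HasFDerivAt (fun s => M (F (cline p v s)))
        (M.comp ((fderiv ℝ F (cline p v s)).comp (clineL v))) s :=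
      M.hasFDerivAt.comp s ((hF _ hs).hasFDerivAt.comp s (cline_deriv p v s))
    rw [differentiableAt_complex_iff_differentiableAt_real]
    refine ⟨hD.differentiableAt, ?_⟩
    rw [hD.fderiv]
    have e1 : clineL v 1 = v := by simp [clineL]
    have e2 : clineL v Complex.I = rot v := by simp [clineL]
    simp only [ContinuousLinearMap.comp_apply, e1, e2, CR_all hI _ (hCR _ hs), hMI, smul_eq_mul]
  have ha := hd.analyticOnNhd hSo
  have := ha.eqOn_zero_of_preconnected_of_frequently_eq_zero hSc.isPreconnected h0
    (hz.mono fun s hs => by rw [hs, map_zero]) ht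
  have h2 := congrArg Complex.re this
  simpa [hM, lam] using h2

lemma open_id {I : EndE n} (hI : I * I = -1) {F : (Fin d → ℝ) × (Fin d → ℝ) → V n}
    {U : Set ((Fin d → ℝ) × (Fin d → ℝ))} (hU : IsOpen U) (hUc : Convex ℝ U)
    (hF : ∀ p ∈ U, DifferentiableAt ℝ F p)
    (hCR : ∀ p ∈ U, ∀ ℓ, fderiv ℝ F p (ex d ℓ) + I (fderiv ℝ F p (ey d ℓ)) = 0)
    {p : (Fin d → ℝ) × (Fin d → ℝ)} (hp : p ∈ U) (hz : ∀ᶠ q in nhds p, F q = 0) :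
    ∀ q ∈ U, F q = 0 := by
  intro q hq
  have e0 : cline p (q - p) 0 = p := by simp [cline]
  have e1 : cline p (q - p) 1 = q := by simp [cline]
  rw [← e1]
  refine line_id hI hU hUc hF hCR p (q - p) (t₀ := 0) (by rwa [e0]) (by rwa [e1]) ?_
  have hc : Filter.Tendsto (cline p (q - p)) (nhds 0) (nhds p) := by
    have := (cline_deriv p (q - p) 0).continuousAt.tendsto
    rwa [e0] at this
  exact ((hc.eventually hz).filter_mono nhdsWithin_le_nhds).frequently

lemma real_id {I : EndE n} (hI : I * I = -1) {F : (Fin d → ℝ) × (Fin d → ℝ) → V n}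
    {x : Fin d → ℝ} {r : ℝ}
    (hF : ∀ p ∈ Metric.ball (x, (0 : Fin d → ℝ)) r, DifferentiableAt ℝ F p)
    (hCR : ∀ p ∈ Metric.ball (x, (0 : Fin d → ℝ)) r, ∀ ℓ,
      fderiv ℝ F p (ex d ℓ) + I (fderiv ℝ F p (ey d ℓ)) = 0)
    (hz : ∀ a ∈ Metric.ball x r, F (a, 0) = 0) :
    ∀ q ∈ Metric.ball (x, (0 : Fin d → ℝ)) r, F q = 0 := by
  rintro ⟨a, b⟩ hq
  have ha : a ∈ Metric.ball x r := by
    rw [Metric.mem_ball, Prod.dist_eq] at hq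
    exact lt_of_le_of_lt (le_max_left _ _) hq
  have hr : 0 < r := lt_of_le_of_lt dist_nonneg ha
  have e0 : cline (a, 0) (b, 0) 0 = ((a, 0) : (Fin d → ℝ) × (Fin d → ℝ)) := by simp [cline]
  have e1 : cline (a, 0) (b, 0) Complex.I = ((a, b) : (Fin d → ℝ) × (Fin d → ℝ)) := by
    simp [cline, rot]
  rw [← e1]
  refine line_id hI Metric.isOpen_ball (convex_ball _ _) hF hCR (a, 0) (b, 0) (t₀ := 0)
    ?_ (by rwa [e1]) ?_
  · rw [e0, Metric.mem_ball, Prod.dist_eq]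
    simpa using ha
  · have h1 : ∀ᶠ s : ℝ in nhds 0, a + s • b ∈ Metric.ball x r := by
      have hc : Continuous fun s : ℝ => a + s • b := by fun_prop
      exact hc.continuousAt.eventually_mem (Metric.isOpen_ball.mem_nhds (by simpa using ha))
    have h2 : ∃ᶠ s : ℝ in nhdsWithin 0 {0}ᶜ, F (cline (a, 0) (b, 0) (s : ℂ)) = 0 := by
      refine ((h1.filter_mono nhdsWithin_le_nhds).mono fun s hs => ?_).frequently
      have : cline (a, 0) (b, 0) (s : ℂ) = ((a + s • b, 0) : (Fin d → ℝ) × (Fin d → ℝ)) := by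
        simp [cline]
      rw [this]
      exact hz _ hs
    have ht : Filter.Tendsto (fun s : ℝ => (s : ℂ)) (nhdsWithin 0 {0}ᶜ) (nhdsWithin 0 {0}ᶜ) := by
      refine tendsto_nhdsWithin_iff.2 ⟨?_, ?_⟩
      · have := Complex.continuous_ofReal.tendsto 0
        simp only [Complex.ofReal_zero] at this
        exact this.mono_left nhdsWithin_le_nhds
      · filter_upwards [self_mem_nhdsWithin] with s hs
        simpa using hs
    exact ht.frequently h2

/-- Local facts on a slice ball. -/
lemma sub_reg {𝒞 : Set (EndE n)} (hn : 1 ≤ n) (hcs : 𝒞 ⊆ CS n)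
    {Ω : Set (Fin d → EndE n)} (hΩ : SliceOpen n d 𝒞 Ω) {f g : (Fin d → EndE n) → V n}
    (hf : WSRegular n d 𝒞 Ω f) (hg : WSRegular n d 𝒞 Ω g) {I : EndE n} (hI : I ∈ 𝒞) :
    ∀ p ∈ Phi n d I ⁻¹' Ω, DifferentiableAt ℝ (fun p => f (Phi n d I p) - g (Phi n d I p)) p ∧
      ∀ ℓ, fderiv ℝ (fun p => f (Phi n d I p) - g (Phi n d I p)) p (ex d ℓ)
        + I (fderiv ℝ (fun p => f (Phi n d I p) - g (Phi n d I p)) p (ey d ℓ)) = 0 := by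
  intro p hp
  have ho := slice_open_pre hn hcs hΩ hI
  have df : DifferentiableAt ℝ (f ∘ Phi n d I) p := (hf I hI).1.differentiableAt (ho.mem_nhds hp)
  have dg : DifferentiableAt ℝ (g ∘ Phi n d I) p := (hg I hI).1.differentiableAt (ho.mem_nhds hp)
  have hD := df.hasFDerivAt.sub dg.hasFDerivAt
  have hD' : HasFDerivAt (fun p => f (Phi n d I p) - g (Phi n d I p)) _ p := hD
  refine ⟨hD'.differentiableAt, fun ℓ => ?_⟩
  rw [hD'.fderiv]
  have h1 := (hf I hI).2 p hp ℓ
  have h2 := (hg I hI).2 p hp ℓ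
  simp only [sub_apply, map_sub]
  rw [sub_add_sub_comm, h1, h2, sub_zero]

lemma real_local {𝒞 : Set (EndE n)} (hn : 1 ≤ n) (hcs : 𝒞 ⊆ CS n)
    {Ω : Set (Fin d → EndE n)} (hΩ : SliceOpen n d 𝒞 Ω) {f g : (Fin d → EndE n) → V n}
    (hf : WSRegular n d 𝒞 Ω f) (hg : WSRegular n d 𝒞 Ω g) {I J : EndE n} (hJ : J ∈ 𝒞)
    {x : Fin d → ℝ} (hx : Phi n d J (x, 0) ∈ Ω)
    (hz : ∀ᶠ a in nhds x, f (Phi n d I (a, 0)) - g (Phi n d I (a, 0)) = 0) :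
    ∀ᶠ p in nhds (x, (0 : Fin d → ℝ)), f (Phi n d J p) - g (Phi n d J p) = 0 := by
  have hIJ : ∀ a : Fin d → ℝ, Phi n d I (a, 0) = Phi n d J (a, 0) := fun a => by
    ext1 ℓ; rw [Phi_real, Phi_real]
  simp only [hIJ] at hz
  obtain ⟨r, hr, h1⟩ := Metric.eventually_nhds_iff_ball.1 hz
  obtain ⟨r', hr', h2⟩ := Metric.isOpen_iff.1 (slice_open_pre hn hcs hΩ hJ) (x, 0) hx
  have hreg := sub_reg hn hcs hΩ hf hg hJ
  have hm : ∀ p ∈ Metric.ball (x, (0 : Fin d → ℝ)) (min r r'), p ∈ Phi n d J ⁻¹' Ω :=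
    fun p hp => h2 (Metric.ball_subset_ball (min_le_right _ _) hp)
  refine Metric.eventually_nhds_iff_ball.2 ⟨min r r', lt_min hr hr', ?_⟩
  exact real_id (F := fun p => f (Phi n d J p) - g (Phi n d J p)) (hcs hJ)
    (fun p hp => (hreg p (hm p hp)).1) (fun p hp => (hreg p (hm p hp)).2)
    (fun a ha => h1 a (Metric.ball_subset_ball (min_le_left _ _) ha))

lemma transfer {𝒞 : Set (EndE n)} (hn : 1 ≤ n) (hcs : 𝒞 ⊆ CS n)
    {Ω : Set (Fin d → EndE n)} (hΩ : SliceOpen n d 𝒞 Ω) {f g : (Fin d → EndE n) → V n}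
    (hf : WSRegular n d 𝒞 Ω f) (hg : WSRegular n d 𝒞 Ω g) {I J : EndE n} (hI : I ∈ 𝒞) (hJ : J ∈ 𝒞)
    {p p' : (Fin d → ℝ) × (Fin d → ℝ)} (hp : Phi n d I p ∈ Ω) (hpp : Phi n d I p = Phi n d J p')
    (hz : ∀ᶠ q in nhds p, f (Phi n d I q) - g (Phi n d I q) = 0) :
    ∀ᶠ q in nhds p', f (Phi n d J q) - g (Phi n d J q) = 0 := by
  obtain ⟨x, y⟩ := p
  obtain ⟨x', y'⟩ := p'
  have key (ℓ : Fin d) := slice_eq hn (hcs hI) (hcs hJ)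
    (congrFun hpp ℓ : x ℓ • (1 : EndE n) + y ℓ • I = x' ℓ • (1 : EndE n) + y' ℓ • J)
  obtain rfl : x = x' := funext fun ℓ => (key ℓ).1
  by_cases hy : y = 0
  · have hy' : y' = 0 := funext fun ℓ => by
      have := (key ℓ).2.2
      rw [hy] at this
      simpa using this.symm
    subst hy hy'
    refine real_local hn hcs hΩ hf hg (I := I) hJ (hpp ▸ hp) ?_
    have hc : Continuous fun a : Fin d → ℝ => (a, (0 : Fin d → ℝ)) := by fun_prop
    exact (hc.tendsto x).eventually hz
  · obtain ⟨ℓ, hℓ⟩ := Function.ne_iff.1 hy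
    have hℓ' : y ℓ ≠ 0 := hℓ
    obtain ⟨-, h1, h2⟩ := key ℓ
    change y ℓ • I = y' ℓ • J at h1
    change y ℓ ^ 2 = y' ℓ ^ 2 at h2
    have hc : ∃ c : ℝ, J = c • I := by
      have : y' ℓ ≠ 0 := by
        intro h0
        rw [h0] at h2
        exact hℓ' (by simpa using h2)
      exact ⟨(y' ℓ)⁻¹ * y ℓ, by rw [mul_smul, h1, smul_smul, inv_mul_cancel₀ this, one_smul]⟩
    obtain ⟨c, hJc⟩ := hc
    have hP : ∀ q : (Fin d → ℝ) × (Fin d → ℝ), Phi n d J q = Phi n d I (q.1, c • q.2) := by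
      intro q
      ext1 k
      simp only [Phi, hJc, Pi.smul_apply, smul_eq_mul]
      module
    have hc : Continuous fun q : (Fin d → ℝ) × (Fin d → ℝ) => (q.1, c • q.2) := by fun_prop
    have hy2 : (x, c • y') = (x, y) := by
      apply (Phi_emb hn (hcs hI)).injective
      rw [hpp, hP]
    have ht := hc.tendsto (x, y')
    simp only [hy2] at ht
    simp only [hP]
    exact ht.eventually hz

lemma main_id {𝒞 : Set (EndE n)} (hn : 1 ≤ n) (hcs : 𝒞 ⊆ CS n)
    {Ω : Set (Fin d → EndE n)} (hΩ : SliceDomain n d 𝒞 Ω) {f g : (Fin d → EndE n) → V n}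
    (hf : WSRegular n d 𝒞 Ω f) (hg : WSRegular n d 𝒞 Ω g) {I : EndE n} (hI : I ∈ 𝒞)
    {p : (Fin d → ℝ) × (Fin d → ℝ)} (hp : Phi n d I p ∈ Ω)
    (hz : ∀ᶠ q in nhds p, f (Phi n d I q) - g (Phi n d I q) = 0) : Set.EqOn f g Ω := by
  obtain ⟨hO, hconn⟩ := hΩ
  let A : Set (Fin d → EndE n) := {q | q ∈ Ω ∧ ∀ J ∈ 𝒞, ∀ p, Phi n d J p = q →
    ∀ᶠ s in nhds p, f (Phi n d J s) - g (Phi n d J s) = 0}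
  have hA : ∀ {J : EndE n}, J ∈ 𝒞 → ∀ {p}, Phi n d J p ∈ Ω →
      (∀ᶠ s in nhds p, f (Phi n d J s) - g (Phi n d J s) = 0) → Phi n d J p ∈ A :=
    fun {J} hJ {p} hp h => ⟨hp, fun K hK p' hp' => transfer hn hcs hO hf hg hJ hK hp hp'.symm h⟩
  have hAo : IsOpen[sliceTop n d 𝒞] A := by
    refine sliceTop_isOpen hn hcs fun J hJ => isOpen_iff_eventually.2 fun p hp => ?_
    filter_upwards [(hp.2 J hJ p rfl).eventually_nhds,
      (slice_open_pre hn hcs hO hJ).mem_nhds hp.1] with s hs hs'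
    exact hA hJ hs' hs
  have hBo : IsOpen[sliceTop n d 𝒞] (Ω \ A) := by
    refine sliceTop_isOpen hn hcs fun J hJ => Metric.isOpen_iff.2 fun p hp => ?_
    obtain ⟨r, hr, hb⟩ := Metric.isOpen_iff.1 (slice_open_pre hn hcs hO hJ) p hp.1
    refine ⟨r, hr, fun s hs => ⟨hb hs, fun hsA => hp.2 (hA hJ hp.1 ?_)⟩⟩
    have hreg := sub_reg hn hcs hO hf hg hJ
    exact Metric.eventually_nhds_iff_ball.2 ⟨r, hr,
      open_id (F := fun p => f (Phi n d J p) - g (Phi n d J p)) (hcs hJ) Metric.isOpen_ball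
        (convex_ball _ _) (fun p hp => (hreg p (hb hp)).1) (fun p hp => (hreg p (hb hp)).2)
        hs (hsA.2 J hJ s rfl)⟩
  have hsub : Ω ⊆ A := by
    refine @IsPreconnected.subset_left_of_subset_union _ (sliceTop n d 𝒞) Ω A (Ω \ A) hAo hBo
      disjoint_sdiff_self_right ?_ ⟨_, hp, hA hI hp hz⟩ hconn.2
    rw [Set.union_diff_self]
    exact Set.subset_union_right
  intro q hq
  obtain ⟨J, hJ, hqJ⟩ := Set.mem_iUnion₂.1 (hO.1 hq)
  rw [← range_Phi] at hqJ
  obtain ⟨p, rfl⟩ := hqJ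
  exact sub_eq_zero.1 ((hsub hq).2 J hJ p rfl).self_of_nhds

end helpers

/-- (Identity Principle) Two weak slice regular functions on a slice-domain agreeing on a
nonempty relatively open subset of Ω ∩ ℝ^d, or of some Ω ∩ ℂ_I^d, agree on all of Ω. -/
theorem identity_principle (n d : ℕ) (hn : 1 ≤ n) (hd : 1 ≤ d)
    (𝒞 : Set (EndE n)) (h𝒞 : 𝒞.Nonempty) (hsym : ∀ I ∈ 𝒞, -I ∈ 𝒞) (hcs : 𝒞 ⊆ CS n)
    (Ω : Set (Fin d → EndE n)) (hΩ : SliceDomain n d 𝒞 Ω)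
    (f g : (Fin d → EndE n) → V n)
    (hf : WSRegular n d 𝒞 Ω f) (hg : WSRegular n d 𝒞 Ω g) :
    (∀ D : Set (Fin d → EndE n), D.Nonempty → D ⊆ Ω ∩ RealSet n d →
        (∃ U : Set (Fin d → EndE n), IsOpen U ∧ D = U ∩ RealSet n d) →
        Set.EqOn f g D → Set.EqOn f g Ω) ∧
    (∀ I ∈ 𝒞, ∀ D : Set (Fin d → EndE n), D.Nonempty → D ⊆ Ω ∩ CId n d I →
        (∃ U : Set (Fin d → EndE n), IsOpen U ∧ D = U ∩ CId n d I) →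
        Set.EqOn f g D → Set.EqOn f g Ω) := by
  constructor
  · rintro D ⟨q, hq⟩ hD ⟨U, hU, rfl⟩ hfg
    obtain ⟨I, hI⟩ := h𝒞
    obtain ⟨hqΩ, hqR⟩ := hD hq
    choose x hx using hqR
    have hmem : ∀ a : Fin d → ℝ, Phi n d I (a, 0) ∈ RealSet n d := fun a ℓ => ⟨a ℓ, Phi_real I a ℓ⟩
    have hqx : Phi n d I (x, 0) = q := funext fun ℓ => by rw [Phi_real, hx]
    subst hqx
    refine main_id hn hcs hΩ hf hg hI hqΩ (real_local hn hcs hΩ.1 hf hg (I := I) hI hqΩ ?_)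
    have hc : Continuous fun a : Fin d → ℝ => Phi n d I (a, 0) :=
      (Phi_emb hn (hcs hI)).continuous.comp (by fun_prop)
    filter_upwards [(hU.preimage hc).mem_nhds hq.1] with a ha
    exact sub_eq_zero.2 (hfg ⟨ha, hmem a⟩)
  · rintro I hI D ⟨q, hq⟩ hD ⟨U, hU, rfl⟩ hfg
    obtain ⟨hqΩ, hqR⟩ := hD hq
    rw [← range_Phi] at hqR
    obtain ⟨p, rfl⟩ := hqR
    refine main_id hn hcs hΩ hf hg hI hqΩ ?_
    filter_upwards [(hU.preimage (Phi_emb hn (hcs hI)).continuous).mem_nhds hq.1] with a ha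
    exact sub_eq_zero.2 (hfg ⟨ha, by rw [← range_Phi]; exact ⟨a, rfl⟩⟩)
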